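/- Let A(s) be an n×n matrix over ℝ[s] with det A(s) ≠ 0. For an n×n polynomial matrix M(s), define δ̂(M) as the minimum of Σ_{j=1}^n q_j − Σ_{i=1}^n p_i over all pairs of nonnegative integer vectors p, q ∈ ℤ≥0ⁿ that are degree-feasible for M(s). Suppose (p,q) ∈ ℤ≥0ⁿ×ℤ≥0ⁿ attains δ̂(A), let J be the tight coefficient matrix of A(s) with respect to (p,q), and suppose U, V are nonsingular real n×n matrices, upper-triangular along p and q respectively, such that for every permutation σ of {1,…,n} there is an index i with (U·J·V)_{i,σ(i)} = 0 (i.e., the term-rank of UJV is less than n). Define Ũ_{ik} = U_{ik}·s^{p_k − p_i} if p_i ≤ p_k (and 0 otherwise), Ṽ_{mj} = V_{mj}·s^{q_j − q_m} if q_m ≤ q_j (and 0 otherwise), and set B(s) = Ũ·A(s)·Ṽ. Then δ̂(B) < δ̂(A). -/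

import Mathlib

open Matrix Polynomial

noncomputable section

/-- The degree of a polynomial, viewed in `ℤ ∪ {−∞}` (`WithBot ℤ`). -/
def degZ (f : Polynomial ℝ) : WithBot ℤ :=
  f.degree.map (Nat.cast : ℕ → ℤ)

/-- `(p, q)` (nonnegative integer vectors) is degree-feasible for the polynomial matrix `M`:
`deg M_{ij} ≤ q_j − p_i` for all `i, j`. -/
def DegFeas (n : ℕ) (M : Matrix (Fin n) (Fin n) (Polynomial ℝ)) (p q : Fin n → ℕ) : Prop :=
  ∀ i j, degZ (M i j) ≤ (((q j : ℤ) - (p i : ℤ) : ℤ) : WithBot ℤ)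

/-- The tight coefficient matrix of a polynomial matrix `A(s)` with respect to `(p, q)`. -/
def tightCoeff (n : ℕ) (A : Matrix (Fin n) (Fin n) (Polynomial ℝ))
    (p q : Fin n → ℤ) : Matrix (Fin n) (Fin n) ℝ :=
  Matrix.of fun i j => if 0 ≤ q j - p i then (A i j).coeff (q j - p i).toNat else 0

/-- The polynomial matrix `diag(s^{−p_i}) · M · diag(s^{p_i})` associated to a real matrix `M`
upper-triangular along `p`: entry `(i,k)` is `M i k · s^{p_k − p_i}` if `p i ≤ p k`, else `0`. -/
def polyConj (n : ℕ) (p : Fin n → ℤ) (M : Matrix (Fin n) (Fin n) ℝ) :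
    Matrix (Fin n) (Fin n) (Polynomial ℝ) :=
  Matrix.of fun i k =>
    if p i ≤ p k then Polynomial.C (M i k) * Polynomial.X ^ (p k - p i).toNat else 0

theorem degZ_le_iff (f : Polynomial ℝ) (d : ℤ) :
    degZ f ≤ (d : WithBot ℤ) ↔ ∀ m : ℕ, d < m → f.coeff m = 0 := by
  constructor
  · intro h m hm
    apply Polynomial.coeff_eq_zero_of_degree_lt
    unfold degZ at h
    cases hf : f.degree with
    | bot => exact WithBot.bot_lt_coe m
    | coe k =>
      rw [hf, WithBot.map_coe, WithBot.coe_le_coe] at h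
      exact WithBot.coe_lt_coe.2 (by exact_mod_cast h.trans_lt hm)
  · intro h
    unfold degZ
    cases hf : f.degree with
    | bot => exact bot_le
    | coe k =>
      rw [WithBot.map_coe, WithBot.coe_le_coe]
      by_contra hlt
      exact Polynomial.coeff_ne_zero_of_eq_degree hf (h k (not_le.1 hlt))

theorem coeff_monomial_mul_mul_monomial (f : Polynomial ℝ) (u v : ℝ) (d : ℤ) (a b m : ℕ)
    (hf : degZ f ≤ (d : WithBot ℤ)) (hm : d + a + b ≤ m) :
    (C u * X ^ a * f * (C v * X ^ b)).coeff m =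
      if (m : ℤ) = d + a + b then u * (if 0 ≤ d then f.coeff d.toNat else 0) * v else 0 := by
  rw [degZ_le_iff] at hf
  have e : C u * X ^ a * f * (C v * X ^ b) = C (u * v) * (f * X ^ (a + b)) := by
    rw [C_mul, pow_add]; ring
  rw [e, coeff_C_mul, coeff_mul_X_pow']
  split_ifs with h1 h2 h3 h2
  · rw [show d.toNat = m - (a + b) by omega]; ring
  · omega
  · rw [hf (m - (a + b)) (by omega), mul_zero]
  · omega
  · simp
  · simp

/-- At and above the degree bound `q j - p i`, the coefficients of the transformed matrix are
those of the transformed tight coefficient matrix. -/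
theorem coeff_polyConj_mul_mul (n : ℕ) (A : Matrix (Fin n) (Fin n) (Polynomial ℝ))
    (p q : Fin n → ℕ) (hfeas : DegFeas n A p q) (U V : Matrix (Fin n) (Fin n) ℝ)
    (hU : ∀ i j, p i > p j → U i j = 0) (hV : ∀ i j, q i > q j → V i j = 0)
    (i j : Fin n) (m : ℕ) (hm : (q j : ℤ) - p i ≤ m) :
    ((polyConj n (fun i => (p i : ℤ)) U * A * polyConj n (fun j => (q j : ℤ)) V) i j).coeff m =
      if (m : ℤ) = q j - p i then
        (U * tightCoeff n A (fun i => (p i : ℤ)) (fun j => (q j : ℤ)) * V) i j else 0 := by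
  have key : ∀ k l, (polyConj n (fun i => (p i : ℤ)) U i k * A k l *
      polyConj n (fun j => (q j : ℤ)) V l j).coeff m = if (m : ℤ) = q j - p i then
        U i k * tightCoeff n A (fun i => (p i : ℤ)) (fun j => (q j : ℤ)) k l * V l j else 0 := by
    intro k l
    simp only [polyConj, tightCoeff, Matrix.of_apply]
    by_cases hp : p i ≤ p k
    · by_cases hq : q l ≤ q j
      · rw [if_pos (by exact_mod_cast hp), if_pos (by exact_mod_cast hq),
          coeff_monomial_mul_mul_monomial _ _ _ _ _ _ _ (hfeas k l) (by omega)]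
        refine if_congr ?_ rfl rfl
        omega
      · rw [if_neg (c := (q l : ℤ) ≤ q j) (by exact_mod_cast hq), hV l j (by omega)]
        simp
    · rw [if_neg (c := (p i : ℤ) ≤ p k) (by exact_mod_cast hp), hU i k (by omega)]
      simp
  simp only [Matrix.mul_apply, Finset.sum_mul, Polynomial.finsetSum_coeff, key]
  split_ifs <;> simp

/-- Hall's theorem for a square matrix of deficient term-rank. -/
theorem exists_card_support_lt {n : ℕ} (M : Matrix (Fin n) (Fin n) ℝ)
    (hM : ∀ σ : Equiv.Perm (Fin n), ∃ i, M i (σ i) = 0) :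
    ∃ s t : Finset (Fin n), t.card < s.card ∧ ∀ i ∈ s, ∀ j ∉ t, M i j = 0 := by
  classical
  by_contra! hcon
  have hall : ∀ s : Finset (Fin n),
      s.card ≤ (s.biUnion fun i => Finset.univ.filter fun j => M i j ≠ 0).card := by
    intro s
    by_contra! hlt
    obtain ⟨i, hi, j, hj, hne⟩ := hcon s _ hlt
    exact hj (Finset.mem_biUnion.2 ⟨i, hi, by simpa using hne⟩)
  obtain ⟨f, hf, hfm⟩ := (Finset.all_card_le_biUnion_card_iff_exists_injective _).1 hall
  obtain ⟨i, hi⟩ := hM (Equiv.ofBijective f (Finite.injective_iff_bijective.1 hf))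
  have := hfm i
  simp only [Finset.mem_filter] at this
  exact this.2 hi

/-- One step of combinatorial relaxation strictly decreases `δ̂`: if `(p,q)` attains
`δ̂(A)`, `J` is the tight coefficient matrix of `A(s)` w.r.t. `(p,q)`, and `U, V` are
nonsingular real matrices, upper-triangular along `p` and `q`, such that `UJV` has term-rank
less than `n`, then `B(s) = Ũ·A(s)·Ṽ` satisfies `δ̂(B) < δ̂(A)`: some degree-feasible
nonnegative pair for `B` has strictly smaller objective value than `Σq − Σp = δ̂(A)`. -/
theorem stmt_14 (n : ℕ) (A : Matrix (Fin n) (Fin n) (Polynomial ℝ))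
    (hA : A.det ≠ 0)
    (p q : Fin n → ℕ) (hfeas : DegFeas n A p q)
    (hopt : ∀ p' q' : Fin n → ℕ, DegFeas n A p' q' →
      (∑ j, (q j : ℤ)) - ∑ i, (p i : ℤ) ≤ (∑ j, (q' j : ℤ)) - ∑ i, (p' i : ℤ))
    (U V : Matrix (Fin n) (Fin n) ℝ) (hUdet : U.det ≠ 0) (hVdet : V.det ≠ 0)
    (hU : ∀ i j, p i > p j → U i j = 0) (hV : ∀ i j, q i > q j → V i j = 0)
    (htrank : ∀ σ : Equiv.Perm (Fin n),
      ∃ i, (U * tightCoeff n A (fun i => (p i : ℤ)) (fun j => (q j : ℤ)) * V) i (σ i) = 0) :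
    ∃ p' q' : Fin n → ℕ,
      DegFeas n (polyConj n (fun i => (p i : ℤ)) U * A * polyConj n (fun j => (q j : ℤ)) V)
        p' q' ∧
      (∑ j, (q' j : ℤ)) - ∑ i, (p' i : ℤ) < (∑ j, (q j : ℤ)) - ∑ i, (p i : ℤ) := by
  classical
  obtain ⟨s, t, hlt, hzero⟩ := exists_card_support_lt _ htrank
  refine ⟨fun i => p i + if i ∈ s then 1 else 0, fun j => q j + if j ∈ t then 1 else 0, ?_, ?_⟩
  · intro i j
    rw [degZ_le_iff]
    intro m hm
    push_cast at hm
    rw [coeff_polyConj_mul_mul n A p q hfeas U V hU hV i j m (by split_ifs at hm <;> omega)]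
    split_ifs with h
    · refine hzero i ?_ j ?_ <;> by_contra hc <;> simp only [hc, if_true, if_false] at hm <;>
        split_ifs at hm <;> omega
    · rfl
  · simp only [Nat.cast_add, Nat.cast_ite, Nat.cast_one, Nat.cast_zero, Finset.sum_add_distrib,
      Finset.sum_ite_mem, Finset.univ_inter, Finset.sum_const, nsmul_eq_mul, mul_one]
    omega

end
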